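/- arXiv:2508.20026 — 2 statements merged into one kernel-verified Lean document; each statement's English description precedes it below -/
import Mathlib

section
/- If 2^k ≤ n < 2^{k+1}, then over ℚ(q): M(n)·(1,1)ᵀ = (q^{−k}·h_q(n−1), q^{−k−1}·h_q(n))ᵀ; that is, the first row sum of M(n) equals q^{−k}·h_q(n−1) and the second row sum equals q^{−k−1}·h_q(n). -/
/-- A multiset of naturals is *hyperbinary* if every element is a power of `2`
and no element occurs more than twice. -/
def IsHyperbinary (μ : Multiset ℕ) : Prop :=
  (∀ x ∈ μ, ∃ i : ℕ, x = 2 ^ i) ∧ ∀ x : ℕ, μ.count x ≤ 2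

open scoped Classical in
/-- `hq n` is the length generating function `h_q(n) = Σ_{η ∈ H(n)} q^{ℓ(η)}`
over the hyperbinary partitions of `n`, as a polynomial in `ℤ[q]`. -/
noncomputable def hq (n : ℕ) : Polynomial ℤ :=
  ∑ p ∈ Finset.univ.filter (fun p : n.Partition => IsHyperbinary p.parts),
      (Polynomial.X : Polynomial ℤ) ^ (Multiset.card p.parts)

/-- `h_q(n)` viewed as an element of the field `ℚ(q)` of rational functions. -/
noncomputable def hqF (n : ℕ) : RatFunc ℚ :=
  algebraMap (Polynomial ℚ) (RatFunc ℚ) ((hq n).map (Int.castRingHom ℚ))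

/-- The matrix `L = [[1, 0], [1, q⁻¹]]` over `ℚ(q)`. -/
noncomputable def Lmat : Matrix (Fin 2) (Fin 2) (RatFunc ℚ) :=
  !![1, 0; 1, RatFunc.X⁻¹]

/-- The matrix `R = [[q, 1], [0, 1]]` over `ℚ(q)`. -/
noncomputable def Rmat : Matrix (Fin 2) (Fin 2) (RatFunc ℚ) :=
  !![RatFunc.X, 1; 0, 1]

/-- `Mmat n` is the product of the matrices obtained by reading the reversed binary
expansion `b_k b_{k-1} … b_2` of `n` (dropping the leading digit `b_1 = 1`) and
replacing each `0` by `L` and each `1` by `R`; it is the identity when `n ≤ 1`.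
Equivalently, `M(1) = 1`, `M(2m) = L * M(m)` and `M(2m+1) = R * M(m)`. -/
noncomputable def Mmat (n : ℕ) : Matrix (Fin 2) (Fin 2) (RatFunc ℚ) :=
  if _h : n ≤ 1 then 1
  else (if n % 2 = 0 then Lmat else Rmat) * Mmat (n / 2)
termination_by n
decreasing_by exact Nat.div_lt_self (by omega) (by omega)

/-- Adjoin `c` ones to the multiset obtained by doubling all elements of `t`. -/
def onesAddDouble (c : ℕ) (t : Multiset ℕ) : Multiset ℕ :=
  Multiset.replicate c 1 + t.map (2 * ·)

theorem onesAddDouble_injective (c : ℕ) : Function.Injective (onesAddDouble c) := fun _ _ h =>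
  Multiset.map_injective (mul_right_injective₀ two_ne_zero) (add_left_cancel h)

theorem card_onesAddDouble (c : ℕ) (t : Multiset ℕ) :
    (onesAddDouble c t).card = c + t.card := by
  simp [onesAddDouble]

theorem sum_onesAddDouble (c : ℕ) (t : Multiset ℕ) :
    (onesAddDouble c t).sum = c + 2 * t.sum := by
  have h : (t.map (2 * ·)).sum = 2 * t.sum := by
    simpa using Multiset.sum_map_mul_left (s := t) (a := 2) (f := id)
  simp [onesAddDouble, h]

theorem count_one_onesAddDouble (c : ℕ) (t : Multiset ℕ) :
    (onesAddDouble c t).count 1 = c := by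
  simp [onesAddDouble]

theorem count_two_mul_onesAddDouble (c : ℕ) (t : Multiset ℕ) (x : ℕ) :
    (onesAddDouble c t).count (2 * x) = t.count x := by
  have h : (t.map (2 * ·)).count (2 * x) = t.count x :=
    Multiset.count_map_eq_count' (2 * ·) t (mul_right_injective₀ two_ne_zero) x
  rw [onesAddDouble, Multiset.count_add, h, Multiset.count_replicate, if_neg (by omega), zero_add]

theorem isHyperbinary_onesAddDouble_iff {c : ℕ} {t : Multiset ℕ} :
    IsHyperbinary (onesAddDouble c t) ↔ c ≤ 2 ∧ IsHyperbinary t := by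
  constructor
  · rintro ⟨hpow, hcount⟩
    refine ⟨count_one_onesAddDouble c t ▸ hcount 1, fun x hx => ?_,
      fun x => count_two_mul_onesAddDouble c t x ▸ hcount (2 * x)⟩
    obtain ⟨i, hi⟩ := hpow (2 * x)
      (Multiset.mem_add.2 (Or.inr (Multiset.mem_map_of_mem (2 * ·) hx)))
    cases i with
    | zero => omega
    | succ i => exact ⟨i, by rw [pow_succ] at hi; omega⟩
  · rintro ⟨hc, hpow, hcount⟩
    refine ⟨fun x hx => ?_, fun x => ?_⟩
    · rcases Multiset.mem_add.1 hx with hx | hx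
      · exact ⟨0, Multiset.eq_of_mem_replicate hx⟩
      · obtain ⟨y, hy, rfl⟩ := Multiset.mem_map.1 hx
        obtain ⟨i, rfl⟩ := hpow y hy
        exact ⟨i + 1, (pow_succ' 2 i).symm⟩
    · by_cases hx : x ∈ onesAddDouble c t
      · rcases Multiset.mem_add.1 hx with hx | hx
        · rw [Multiset.eq_of_mem_replicate hx, count_one_onesAddDouble]
          exact hc
        · obtain ⟨y, -, rfl⟩ := Multiset.mem_map.1 hx
          exact (count_two_mul_onesAddDouble c t y).trans_le (hcount y)
      · rw [Multiset.count_eq_zero_of_notMem hx]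
        exact Nat.zero_le 2

theorem IsHyperbinary.exists_eq_onesAddDouble {s : Multiset ℕ} (hs : IsHyperbinary s) :
    ∃ c t, c ≤ 2 ∧ IsHyperbinary t ∧ s = onesAddDouble c t := by
  have key : s = onesAddDouble (s.count 1) ((s.filter (¬ · = 1)).map (· / 2)) := by
    rw [onesAddDouble, ← Multiset.filter_eq', Multiset.map_map]
    conv_lhs => rw [← Multiset.filter_add_not (· = 1) s]
    congr 1
    conv_lhs => rw [← Multiset.map_id (s.filter (¬ · = 1))]
    refine Multiset.map_congr rfl fun x hx => ?_
    obtain ⟨hx, hx1⟩ := Multiset.mem_filter.1 hx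
    obtain ⟨i, rfl⟩ := hs.1 x hx
    cases i with
    | zero => exact absurd rfl hx1
    | succ i => simp [pow_succ']
  have h := isHyperbinary_onesAddDouble_iff.1 (key ▸ hs)
  exact ⟨_, _, h.1, h.2, key⟩

open scoped Classical in
/-- The finset of hyperbinary partitions of `n`, as multisets. -/
noncomputable def hyperbinaryFinset (n : ℕ) : Finset (Multiset ℕ) :=
  (Finset.univ.filter fun p : n.Partition => IsHyperbinary p.parts).image Nat.Partition.parts

theorem mem_hyperbinaryFinset {n : ℕ} {s : Multiset ℕ} :
    s ∈ hyperbinaryFinset n ↔ IsHyperbinary s ∧ s.sum = n := by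
  simp only [hyperbinaryFinset, Finset.mem_image, Finset.mem_filter, Finset.mem_univ, true_and]
  constructor
  · rintro ⟨p, hp, rfl⟩
    exact ⟨hp, p.parts_sum⟩
  · rintro ⟨hs, hn⟩
    refine ⟨⟨s, fun {x} hx => ?_, hn⟩, hs, rfl⟩
    obtain ⟨i, rfl⟩ := hs.1 x hx
    positivity

theorem hq_eq_sum_hyperbinaryFinset (n : ℕ) :
    hq n = ∑ s ∈ hyperbinaryFinset n, (Polynomial.X : Polynomial ℤ) ^ s.card := by
  rw [hyperbinaryFinset, Finset.sum_image fun _ _ _ _ h => Nat.Partition.ext h, hq]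

theorem sum_image_onesAddDouble (c n : ℕ) :
    ∑ s ∈ (hyperbinaryFinset n).image (onesAddDouble c), (Polynomial.X : Polynomial ℤ) ^ s.card =
      Polynomial.X ^ c * hq n := by
  rw [Finset.sum_image (onesAddDouble_injective c).injOn, hq_eq_sum_hyperbinaryFinset,
    Finset.mul_sum]
  simp only [card_onesAddDouble, pow_add]

theorem hq_zero : hq 0 = 1 := by
  have h : hyperbinaryFinset 0 = {0} := by
    ext s
    rw [mem_hyperbinaryFinset, Finset.mem_singleton]
    constructor
    · rintro ⟨hs, h0⟩
      refine Multiset.eq_zero_of_forall_notMem fun x hx => ?_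
      obtain ⟨i, hi⟩ := hs.1 x hx
      have := Multiset.sum_eq_zero_iff.1 h0 x hx
      exact pow_ne_zero i two_ne_zero (hi.symm.trans this)
    · rintro rfl
      simp [IsHyperbinary]
  simp [hq_eq_sum_hyperbinaryFinset, h]

theorem hq_two_mul_add_one (m : ℕ) : hq (2 * m + 1) = Polynomial.X * hq m := by
  have h : hyperbinaryFinset (2 * m + 1) = (hyperbinaryFinset m).image (onesAddDouble 1) := by
    ext s
    simp only [Finset.mem_image, mem_hyperbinaryFinset]
    constructor
    · rintro ⟨hs, hsum⟩
      obtain ⟨c, t, hc, ht, rfl⟩ := hs.exists_eq_onesAddDouble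
      rw [sum_onesAddDouble] at hsum
      obtain rfl : c = 1 := by omega
      exact ⟨t, ⟨ht, by omega⟩, rfl⟩
    · rintro ⟨t, ⟨ht, rfl⟩, rfl⟩
      exact ⟨isHyperbinary_onesAddDouble_iff.2 ⟨by omega, ht⟩,
        by rw [sum_onesAddDouble, add_comm]⟩
  rw [hq_eq_sum_hyperbinaryFinset, h, sum_image_onesAddDouble, pow_one]

theorem hq_two_mul_add_two (m : ℕ) :
    hq (2 * m + 2) = hq (m + 1) + Polynomial.X ^ 2 * hq m := by
  have h : hyperbinaryFinset (2 * m + 2) = (hyperbinaryFinset (m + 1)).image (onesAddDouble 0) ∪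
      (hyperbinaryFinset m).image (onesAddDouble 2) := by
    ext s
    simp only [Finset.mem_union, Finset.mem_image, mem_hyperbinaryFinset]
    constructor
    · rintro ⟨hs, hsum⟩
      obtain ⟨c, t, hc, ht, rfl⟩ := hs.exists_eq_onesAddDouble
      rw [sum_onesAddDouble] at hsum
      obtain rfl | rfl : c = 0 ∨ c = 2 := by omega
      · exact Or.inl ⟨t, ⟨ht, by omega⟩, rfl⟩
      · exact Or.inr ⟨t, ⟨ht, by omega⟩, rfl⟩
    · rintro (⟨t, ⟨ht, hsum⟩, rfl⟩ | ⟨t, ⟨ht, hsum⟩, rfl⟩)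
      all_goals
        refine ⟨isHyperbinary_onesAddDouble_iff.2 ⟨by omega, ht⟩, ?_⟩
        rw [sum_onesAddDouble]
        omega
  have hdisj : Disjoint ((hyperbinaryFinset (m + 1)).image (onesAddDouble 0))
      ((hyperbinaryFinset m).image (onesAddDouble 2)) := by
    simp only [Finset.disjoint_left, Finset.mem_image]
    rintro _ ⟨t, -, rfl⟩ ⟨u, -, hu⟩
    have := congrArg (Multiset.count 1) hu
    simp [count_one_onesAddDouble] at this
  rw [hq_eq_sum_hyperbinaryFinset, h, Finset.sum_union hdisj, sum_image_onesAddDouble,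
    sum_image_onesAddDouble, pow_zero, one_mul]

theorem hqF_zero : hqF 0 = 1 := by
  simp [hqF, hq_zero]

theorem hqF_two_mul_add_one (m : ℕ) : hqF (2 * m + 1) = RatFunc.X * hqF m := by
  simp [hqF, hq_two_mul_add_one]

theorem hqF_two_mul_add_two (m : ℕ) :
    hqF (2 * m + 2) = hqF (m + 1) + RatFunc.X ^ 2 * hqF m := by
  simp [hqF, hq_two_mul_add_two]

theorem Mmat_one : Mmat 1 = 1 := by
  rw [Mmat, dif_pos le_rfl]

theorem Mmat_two_mul_add_two (m : ℕ) : Mmat (2 * m + 2) = Lmat * Mmat (m + 1) := by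
  rw [Mmat, dif_neg (by omega), if_pos (by omega), show (2 * m + 2) / 2 = m + 1 by omega]

theorem Mmat_two_mul_add_three (m : ℕ) : Mmat (2 * m + 3) = Rmat * Mmat (m + 1) := by
  rw [Mmat, dif_neg (by omega), if_neg (by omega), show (2 * m + 3) / 2 = m + 1 by omega]

/-- If `2^k ≤ n < 2^{k+1}` then `M(n)·(1,1)ᵀ = (q^{-k} h_q(n-1), q^{-k-1} h_q(n))ᵀ`
over `ℚ(q)`. -/
theorem Mmat_rowSums (k n : ℕ) (h1 : 2 ^ k ≤ n) (h2 : n < 2 ^ (k + 1)) :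
    (Mmat n).mulVec ![1, 1] =
      ![(RatFunc.X : RatFunc ℚ) ^ (-(k : ℤ)) * hqF (n - 1),
        (RatFunc.X : RatFunc ℚ) ^ (-(k : ℤ) - 1) * hqF n] := by
  have hX : (RatFunc.X : RatFunc ℚ) ≠ 0 := RatFunc.X_ne_zero
  induction k generalizing n with
  | zero =>
    obtain rfl : n = 1 := by simp at h1 h2; omega
    have h : hqF 1 = RatFunc.X := by simpa [hqF_zero] using hqF_two_mul_add_one 0
    simp [Mmat_one, hqF_zero, h, hX]
  | succ k ih =>
    rw [pow_succ] at h1 h2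
    have hk : 0 < 2 ^ k := by positivity
    obtain ⟨m, rfl | rfl⟩ : ∃ m, n = 2 * m + 2 ∨ n = 2 * m + 3 := ⟨n / 2 - 1, by omega⟩
    · rw [Mmat_two_mul_add_two, ← Matrix.mulVec_mulVec, ih (m + 1) (by omega) (by omega),
        show 2 * m + 2 - 1 = 2 * m + 1 by omega, hqF_two_mul_add_one, hqF_two_mul_add_two]
      ext i
      fin_cases i
      all_goals
        simp [Lmat, Matrix.mulVec, dotProduct, Fin.sum_univ_two, zpow_sub₀ hX, zpow_add₀ hX,
          zpow_neg]
        field_simp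
        try ring
    · rw [Mmat_two_mul_add_three, ← Matrix.mulVec_mulVec, ih (m + 1) (by omega) (by omega),
        show 2 * m + 3 - 1 = 2 * m + 2 by omega, show 2 * m + 3 = 2 * (m + 1) + 1 by omega,
        hqF_two_mul_add_one, hqF_two_mul_add_two]
      ext i
      fin_cases i
      all_goals
        simp [Rmat, Matrix.mulVec, dotProduct, Fin.sum_univ_two, zpow_sub₀ hX, zpow_add₀ hX,
          zpow_neg]
        field_simp
        try ring
end

section
/- For every n ≥ 1, the poset D(n) has a minimum element 0̂(n) (an element below every element of D(n) in the refinement order), and 0̂(n) is the unique element of D(n) all of whose zero digits form a prefix (i.e., every zero digit occurs before every nonzero digit). -/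
/-- `d : Fin (Nat.size n) → ℕ` is a hyperbinary expansion `d_1 … d_k` of `n`
(indexed from `0`, so `d i` is the coefficient of `2^(k-1-i)` where `k = Nat.size n`
is the number of binary digits of `n`): all digits are at most `2` and
`Σ_i d_i 2^(k-1-i) = n`. -/
def IsHypExp (n : ℕ) (d : Fin (Nat.size n) → ℕ) : Prop :=
  (∀ i, d i ≤ 2) ∧ ∑ i, d i * 2 ^ (Nat.size n - 1 - (i : ℕ)) = n

/-- `ElemMove d c` : the word `c` is obtained from `d` by one elementary move,
replacing an adjacent pair `(d i, d (i+1)) = (a, 0)` with `a > 0` by `(a - 1, 2)`. -/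
def ElemMove {k : ℕ} (d c : Fin k → ℕ) : Prop :=
  ∃ (i j : Fin k), (j : ℕ) = (i : ℕ) + 1 ∧ 0 < d i ∧ d j = 0 ∧
    c i = d i - 1 ∧ c j = 2 ∧ ∀ t, t ≠ i → t ≠ j → c t = d t

/-- The refinement order on hyperbinary expansions: `HypLe c d` iff `c` can be obtained
from `d` by a (possibly empty) sequence of elementary moves; it is the
reflexive-transitive closure of the elementary-move relation. -/
def HypLe {k : ℕ} (c d : Fin k → ℕ) : Prop :=
  Relation.ReflTransGen (fun x y => ElemMove y x) c d

/-- Every zero digit of `d` occurs before every nonzero digit (the zeros of `d`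
form a prefix). -/
def ZeroPrefix {k : ℕ} (d : Fin k → ℕ) : Prop :=
  ∀ i j : Fin k, i < j → d j = 0 → d i = 0

/-- The value `Σ_i d_i 2^(k-1-i)` of a word of length `k`. -/
def wordValue {k : ℕ} (d : Fin k → ℕ) : ℕ :=
  ∑ i, d i * 2 ^ (k - 1 - (i : ℕ))

theorem wordValue_succ {k : ℕ} (d : Fin (k + 1) → ℕ) :
    wordValue d = 2 * wordValue (fun i : Fin k => d i.castSucc) + d (Fin.last k) := by
  unfold wordValue
  rw [Fin.sum_univ_castSucc, Finset.mul_sum]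
  congr 1
  · refine Finset.sum_congr rfl fun i _ => ?_
    have h : k + 1 - 1 - (i.castSucc : ℕ) = (k - 1 - (i : ℕ)) + 1 := by
      have := i.isLt
      simp only [Fin.val_castSucc]
      omega
    rw [h, pow_succ]
    ring
  · simp

theorem ZeroPrefix.castSucc {k : ℕ} {d : Fin (k + 1) → ℕ} (h : ZeroPrefix d) :
    ZeroPrefix (fun i : Fin k => d i.castSucc) :=
  fun i j hij hj => h i.castSucc j.castSucc (Fin.castSucc_lt_castSucc_iff.mpr hij) hj

theorem eq_zero_of_wordValue_eq_zero {k : ℕ} {d : Fin k → ℕ} (h : wordValue d = 0) :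
    d = 0 := by
  unfold wordValue at h
  funext i
  simpa using (Finset.sum_eq_zero_iff.mp h) i (Finset.mem_univ i)

theorem ZeroPrefix.eq_zero_of_last {k : ℕ} {d : Fin (k + 1) → ℕ} (h : ZeroPrefix d)
    (hl : d (Fin.last k) = 0) : d = 0 := by
  funext i
  rcases (Fin.le_last i).lt_or_eq with hi | rfl
  · exact h i _ hi hl
  · exact hl

theorem wordValue_zero {k : ℕ} : wordValue (0 : Fin k → ℕ) = 0 := by
  simp [wordValue]

/-- A word with digits at most `2` whose zeros form a prefix is determined by its value. -/
theorem ZeroPrefix.eq_of_wordValue_eq {k : ℕ} {d e : Fin k → ℕ}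
    (hd : ZeroPrefix d) (he : ZeroPrefix e) (hd2 : ∀ i, d i ≤ 2) (he2 : ∀ i, e i ≤ 2)
    (h : wordValue d = wordValue e) : d = e := by
  induction k with
  | zero => exact Subsingleton.elim _ _
  | succ k ih =>
    by_cases hdl : d (Fin.last k) = 0
    · obtain rfl := hd.eq_zero_of_last hdl
      rw [wordValue_zero] at h
      exact (eq_zero_of_wordValue_eq_zero h.symm).symm
    by_cases hel : e (Fin.last k) = 0
    · obtain rfl := he.eq_zero_of_last hel
      rw [wordValue_zero] at h
      exact eq_zero_of_wordValue_eq_zero h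
    rw [wordValue_succ, wordValue_succ] at h
    have h1 := hd2 (Fin.last k)
    have h2 := he2 (Fin.last k)
    have hinit := ih hd.castSucc he.castSucc (fun i => hd2 _) (fun i => he2 _) (by omega)
    funext i
    refine Fin.lastCases ?_ (fun j => congrFun hinit j) i
    omega

/-- Every number below `2 ^ k` is the value of a word of length `k` with digits at most `2`. -/
theorem exists_wordValue_eq {k n : ℕ} (h : n < 2 ^ k) :
    ∃ d : Fin k → ℕ, (∀ i, d i ≤ 2) ∧ wordValue d = n := by
  induction k generalizing n with
  | zero =>
    refine ⟨0, fun i => i.elim0, ?_⟩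
    rw [wordValue_zero]
    rw [pow_zero] at h
    omega
  | succ k ih =>
    obtain ⟨d, hd, hv⟩ := ih (n := n / 2) (by rw [pow_succ] at h; omega)
    refine ⟨Fin.snoc d (n % 2), fun i => ?_, ?_⟩
    · refine Fin.lastCases ?_ (fun j => ?_) i
      · rw [Fin.snoc_last]
        omega
      · simpa using hd j
    · rw [wordValue_succ]
      simp only [Fin.snoc_castSucc, Fin.snoc_last, hv]
      omega

theorem ElemMove.le_two {k : ℕ} {d c : Fin k → ℕ} (h : ElemMove d c) (hd : ∀ i, d i ≤ 2)
    (t : Fin k) : c t ≤ 2 := by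
  obtain ⟨i, j, -, -, -, hci, hcj, hc⟩ := h
  by_cases hti : t = i
  · subst hti
    have := hd t
    omega
  by_cases htj : t = j
  · subst htj
    omega
  · rw [hc t hti htj]
    exact hd t

/-- The effect of an elementary move on a weighted sum of the digits. -/
theorem ElemMove.exists_sum_mul {k : ℕ} {d c : Fin k → ℕ} (h : ElemMove d c) :
    ∃ i j : Fin k, (j : ℕ) = (i : ℕ) + 1 ∧ ∀ w : Fin k → ℕ,
      ∑ t, c t * w t + w i = ∑ t, d t * w t + 2 * w j := by
  obtain ⟨i, j, hij, hdi, hdj, hci, hcj, hc⟩ := h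
  refine ⟨i, j, hij, fun w => ?_⟩
  have hne : i ≠ j := by
    rintro rfl
    omega
  have hpt : ∀ t, c t * w t + (if t = i then w t else 0)
      = d t * w t + (if t = j then 2 * w t else 0) := by
    intro t
    by_cases hti : t = i
    · subst hti
      obtain ⟨a, ha⟩ := Nat.exists_eq_add_of_lt hdi
      rw [if_pos rfl, if_neg hne, hci, ha, zero_add, Nat.add_sub_cancel]
      ring
    by_cases htj : t = j
    · subst htj
      simp [hti, hcj, hdj]
    · simp [hti, htj, hc t hti htj]
  have hsum := Finset.sum_congr (rfl : (Finset.univ : Finset (Fin k)) = _) fun t _ => hpt t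
  simpa [Finset.sum_add_distrib] using hsum

theorem ElemMove.wordValue_eq {k : ℕ} {d c : Fin k → ℕ} (h : ElemMove d c) :
    wordValue c = wordValue d := by
  obtain ⟨i, j, hij, hw⟩ := h.exists_sum_mul
  have hs := hw fun t => 2 ^ (k - 1 - (t : ℕ))
  have he : k - 1 - (i : ℕ) = (k - 1 - (j : ℕ)) + 1 := by
    have := j.isLt
    omega
  simp only [he, pow_succ] at hs
  unfold wordValue
  omega

theorem ElemMove.sum_eq {k : ℕ} {d c : Fin k → ℕ} (h : ElemMove d c) :
    ∑ t, c t = ∑ t, d t + 1 := by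
  obtain ⟨i, j, -, hw⟩ := h.exists_sum_mul
  have hs := hw fun _ => 1
  simp only [mul_one] at hs
  omega

/-- A word admitting no elementary move has its zeros as a prefix. -/
theorem zeroPrefix_of_forall_not_elemMove {k : ℕ} {d : Fin k → ℕ}
    (h : ∀ c, ¬ ElemMove d c) : ZeroPrefix d := by
  have hadj : ∀ i j : Fin k, (j : ℕ) = (i : ℕ) + 1 → d j = 0 → d i = 0 := by
    intro i j hij hj
    by_contra hi
    have hne : i ≠ j := by
      rintro rfl
      omega
    refine h (Function.update (Function.update d i (d i - 1)) j 2)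
      ⟨i, j, hij, Nat.pos_of_ne_zero hi, hj, by simp [hne], by simp, fun t hti htj => ?_⟩
    simp [hti, htj]
  have hstep : ∀ (m : ℕ) (i j : Fin k), (j : ℕ) = (i : ℕ) + m → d j = 0 → d i = 0 := by
    intro m
    induction m with
    | zero =>
      intro i j hij hj
      rwa [← Fin.ext hij]
    | succ m ih =>
      intro i j hij hj
      have hlt : (i : ℕ) + m < k := by
        have := j.isLt
        omega
      exact ih i ⟨(i : ℕ) + m, hlt⟩ rfl (hadj _ j hij hj)
  intro i j hij hj
  have hlt : (i : ℕ) < j := hij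
  exact hstep (j - i) i j (by omega) hj

/-- Every word with digits at most `2` lies above one of the same value whose zeros form a
prefix. -/
theorem exists_zeroPrefix_hypLe {k : ℕ} (d : Fin k → ℕ) (hd : ∀ i, d i ≤ 2) :
    ∃ m : Fin k → ℕ, (∀ i, m i ≤ 2) ∧ wordValue m = wordValue d ∧ ZeroPrefix m ∧ HypLe m d := by
  induction hN : 2 * k - ∑ t, d t using Nat.strong_induction_on generalizing d with
  | _ N ih =>
    by_cases hmove : ∃ c, ElemMove d c
    · obtain ⟨c, hc⟩ := hmove
      have hc2 := hc.le_two hd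
      have hbound : ∑ t, c t ≤ 2 * k := by
        have := Finset.sum_le_card_nsmul Finset.univ c 2 fun t _ => hc2 t
        simpa [mul_comm] using this
      have hsum := hc.sum_eq
      obtain ⟨m, hm2, hmv, hmz, hmc⟩ := ih (2 * k - ∑ t, c t) (by omega) c hc2 rfl
      exact ⟨m, hm2, hmv.trans hc.wordValue_eq, hmz, Relation.ReflTransGen.tail hmc hc⟩
    · exact ⟨d, hd, rfl, zeroPrefix_of_forall_not_elemMove (not_exists.mp hmove),
        Relation.ReflTransGen.refl⟩

/-- For every `n ≥ 1`, the poset `D(n)` has a minimum element `0̂(n)`, and `0̂(n)` is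
the unique element of `D(n)` all of whose zero digits form a prefix. -/
theorem exists_min_zeroPrefix (n : ℕ) (hn : 1 ≤ n) :
    ∃ m : Fin (Nat.size n) → ℕ,
      (IsHypExp n m ∧ ∀ d, IsHypExp n d → HypLe m d) ∧
      ZeroPrefix m ∧
      ∀ d, IsHypExp n d → ZeroPrefix d → d = m := by
  obtain ⟨b, hb2, hbv⟩ := exists_wordValue_eq (Nat.lt_size_self n)
  obtain ⟨m, hm2, hmv, hmz, -⟩ := exists_zeroPrefix_hypLe b hb2
  refine ⟨m, ⟨⟨hm2, hmv.trans hbv⟩, fun d hd => ?_⟩, hmz, fun d hd hdz =>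
    hdz.eq_of_wordValue_eq hmz hd.1 hm2 (hd.2.trans (hmv.trans hbv).symm)⟩
  obtain ⟨e, he2, hev, hez, hed⟩ := exists_zeroPrefix_hypLe d hd.1
  have hem : e = m :=
    hez.eq_of_wordValue_eq hmz he2 hm2 ((hev.trans hd.2).trans (hmv.trans hbv).symm)
  exact hem ▸ hed
end
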